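/- Let G_1,…,G_{n2} : ℝ^{N2} → ℝ^{N1} be differentiable, each L_G-smooth with B_G-bounded Jacobian, G = (1/n2) Σ_j G_j, and let F : ℝ^{N1} → ℝ be differentiable, L_F-smooth and with B_F-bounded gradient. Let f : ℝ^{N2} → ℝ be convex, differentiable with ∇f(x) = [∇G(x)]ᵀ ∇F(G(x)) for all x, and L-smooth (L > 0). Let h : ℝ^{N2} → ℝ be μ-strongly convex (μ > 0), H = f + h with minimizer x*. Let α > 0, τ₁ ∈ (0, 1/(3αL)], τ₂ ∈ [0, 1 − τ₁]. Fix z_k, y_k, x̃ ∈ ℝ^{N2}, set x_{k+1} = τ₁ z_k + τ₂ x̃ + (1 − τ₁ − τ₂) y_k, and fix integers A, B ≥ 1. For σ : {1,…,A} → {1,…,n2} and τ : {1,…,B} → {1,…,n2}, let Ĝ(σ) = (1/A) Σ_t (G_{σ(t)}(x_{k+1}) − G_{σ(t)}(x̃)) + G(x̃), ∇Ĝ(τ) = (1/B) Σ_t (∇G_{τ(t)}(x_{k+1}) − ∇G_{τ(t)}(x̃)) + ∇G(x̃), and ∇̃(σ,τ) = [∇Ĝ(τ)]ᵀ ∇F(Ĝ(σ)).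 For each (σ,τ) let z_{k+1}(σ,τ) minimize z ↦ ⟨∇̃(σ,τ), z⟩ + (1/(2α))‖z − z_k‖² + h(z) and y_{k+1}(σ,τ) minimize y ↦ ⟨∇̃(σ,τ), y⟩ + (3L/2)‖y − x_{k+1}‖² + h(y) over ℝ^{N2}. Set M = 3(1/(4τ₁L) + 3/μ)(2 B_G⁴ L_F² / A + 2 B_F² L_G² / B). Then, with E denoting the uniform average over all pairs (σ,τ): 0 ≤ ((1 − τ₁ − τ₂)/τ₁ + (2M/μ)(1 − τ₁ − τ₂)²)(H(y_k) − H(x*)) − (1/τ₁)(E[H(y_{k+1}(σ,τ))] − H(x*)) + (τ₂/τ₁ + (2M/μ)(1 − τ₂)²)(H(x̃) − H(x*)) + (1/(2α) + μ/12 + M τ₁²)‖z_k − x*‖² − ((1 + αμ)/(2α)) E[‖z_{k+1}(σ,τ) − x*‖²]. -/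

import Mathlib

open Matrix
open scoped RealInnerProductSpace

/-- The Frobenius norm of a real matrix. -/
noncomputable def frobNorm {k l : Type*} [Fintype k] [Fintype l] (M : Matrix k l ℝ) : ℝ :=
  Real.sqrt (∑ i, ∑ j, (M i j) ^ 2)

section Convexity

variable {E : Type*} [NormedAddCommGroup E] [InnerProductSpace ℝ E]

/-- A strongly convex function grows quadratically away from a minimizer. -/
lemma StrongConvexOn.add_sq_le_of_forall_le {m : ℝ} {φ : E → ℝ}
    (hφ : StrongConvexOn Set.univ m φ) {p : E} (hp : ∀ z, φ p ≤ φ z) (z : E) :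
    φ p + m / 2 * ‖z - p‖ ^ 2 ≤ φ z := by
  have key : ∀ t ∈ Set.Ioo (0 : ℝ) 1, φ p + (1 - t) * (m / 2 * ‖z - p‖ ^ 2) ≤ φ z := by
    rintro t ⟨ht0, ht1⟩
    have h1 := hφ.2 (Set.mem_univ z) (Set.mem_univ p) ht0.le (sub_nonneg.2 ht1.le)
      (add_sub_cancel t 1)
    have h2 := hp (t • z + (1 - t) • p)
    simp only [smul_eq_mul] at h1
    refine le_of_mul_le_mul_left ?_ ht0
    linarith
  have hlim : Filter.Tendsto (fun t : ℝ => φ p + (1 - t) * (m / 2 * ‖z - p‖ ^ 2))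
      (nhdsWithin 0 (Set.Ioi 0)) (nhds (φ p + (1 - 0) * (m / 2 * ‖z - p‖ ^ 2))) :=
    (Continuous.tendsto (by fun_prop) 0).mono_left nhdsWithin_le_nhds
  rw [sub_zero, one_mul] at hlim
  refine le_of_tendsto hlim ?_
  filter_upwards [Ioo_mem_nhdsGT (zero_lt_one' ℝ)] with t ht using key t ht

/-- The proximal inequality: a minimizer of a linearized, quadratically regularized strongly convex
function. -/
lemma proximal_inequality {μ c : ℝ} {h : E → ℝ}
    (hh : StrongConvexOn Set.univ μ h) {g w p : E}
    (hp : ∀ z, ⟪g, p⟫ + c / 2 * ‖p - w‖ ^ 2 + h p ≤ ⟪g, z⟫ + c / 2 * ‖z - w‖ ^ 2 + h z) (z : E) :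
    ⟪g, p⟫ + c / 2 * ‖p - w‖ ^ 2 + h p + (c + μ) / 2 * ‖z - p‖ ^ 2
      ≤ ⟪g, z⟫ + c / 2 * ‖z - w‖ ^ 2 + h z := by
  refine StrongConvexOn.add_sq_le_of_forall_le
    (φ := fun z => ⟪g, z⟫ + c / 2 * ‖z - w‖ ^ 2 + h z) (m := c + μ) ?_ hp z
  rw [strongConvexOn_iff_convex] at hh ⊢
  have hlin : ConvexOn ℝ Set.univ (fun z : E => innerSL ℝ (g - c • w) z) :=
    (innerSL ℝ (g - c • w)).toLinearMap.convexOn convex_univ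
  refine ((hh.add hlin).add_const (c / 2 * ‖w‖ ^ 2)).congr fun u _ => ?_
  simp only [Pi.add_apply, innerSL_apply_apply, inner_sub_left, inner_smul_left, norm_sub_sq_real,
    real_inner_comm w u, RCLike.conj_to_real]
  ring

variable [CompleteSpace E] {f : E → ℝ}

lemma hasDerivAt_comp_add_smul (hf : Differentiable ℝ f) (x d : E) (t : ℝ) :
    HasDerivAt (fun s : ℝ => f (x + s • d)) ⟪gradient f (x + t • d), d⟫ t := by
  have h1 := (hf (x + t • d)).hasGradientAt.hasFDerivAt
  have h2 : HasDerivAt (fun s : ℝ => x + s • d) d t := by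
    simpa using ((hasDerivAt_id t).smul_const d).const_add x
  exact h1.comp_hasDerivAt t h2

lemma ConvexOn.add_inner_gradient_le (hc : ConvexOn ℝ Set.univ f) (hf : Differentiable ℝ f)
    (x y : E) : f x + ⟪gradient f x, y - x⟫ ≤ f y := by
  have hconv : ConvexOn ℝ Set.univ (fun s : ℝ => f (x + s • (y - x))) := by
    have := hc.comp_affineMap (AffineMap.lineMap (k := ℝ) x y)
    refine this.congr fun s _ => ?_
    simp [AffineMap.lineMap_apply, add_comm]
  have hd := hasDerivAt_comp_add_smul hf x (y - x) 0
  have := hconv.le_slope_of_hasDerivAt (Set.mem_univ 0) (Set.mem_univ 1) zero_lt_one hd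
  simp only [slope_def_field, zero_smul, one_smul, add_zero, add_sub_cancel, sub_zero,
    div_one] at this
  linarith

/-- The descent lemma. -/
lemma le_add_inner_gradient_add_sq {L : ℝ} (hf : Differentiable ℝ f)
    (hs : ∀ x y, ‖gradient f x - gradient f y‖ ≤ L * ‖x - y‖) (x y : E) :
    f y ≤ f x + ⟪gradient f x, y - x⟫ + L / 2 * ‖y - x‖ ^ 2 := by
  set d := y - x with hd
  have hder : ∀ t : ℝ, HasDerivAt
      (fun s : ℝ => f (x + s • d) - s * ⟪gradient f x, d⟫ - s ^ 2 * (L / 2 * ‖d‖ ^ 2))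
      (⟪gradient f (x + t • d), d⟫ - 1 * ⟪gradient f x, d⟫
        - (2 : ℕ) * t ^ (2 - 1) * (L / 2 * ‖d‖ ^ 2)) t := fun t =>
    ((hasDerivAt_comp_add_smul hf x d t).sub ((hasDerivAt_id t).mul_const _)).sub
      ((hasDerivAt_pow 2 t).mul_const _)
  have hanti := antitoneOn_of_deriv_nonpos (convex_Icc (0 : ℝ) 1)
    (fun t _ => (hder t).continuousAt.continuousWithinAt)
    (fun t _ => (hder t).differentiableAt.differentiableWithinAt) (by
      intro t ht
      rw [interior_Icc] at ht
      rw [(hder t).deriv]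
      have h1 : ⟪gradient f (x + t • d) - gradient f x, d⟫ ≤ L * ‖t • d‖ * ‖d‖ := by
        refine (real_inner_le_norm _ _).trans (mul_le_mul_of_nonneg_right ?_ (norm_nonneg _))
        simpa using hs (x + t • d) x
      rw [norm_smul, Real.norm_of_nonneg ht.1.le, inner_sub_left] at h1
      push_cast
      nlinarith)
  have := hanti (Set.left_mem_Icc.2 zero_le_one) (Set.right_mem_Icc.2 zero_le_one) zero_le_one
  simp only [zero_smul, one_smul, add_zero, hd, add_sub_cancel] at this
  rw [hd]
  linarith

/-- One coupled proximal step with an inexact gradient `g`, compared with the point `u`. -/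
lemma coupled_proximal_step {h : E → ℝ} {L μ α τ₁ τ₂ : ℝ} (hL : 0 < L) (hμ : 0 < μ) (hα : 0 < α)
    (hτ₁ : 0 < τ₁) (hτ₁' : τ₁ ≤ 1 / (3 * α * L)) (hτ₂ : 0 ≤ τ₂) (hτ₂' : τ₂ ≤ 1 - τ₁)
    (hfconv : ConvexOn ℝ Set.univ f) (hf : Differentiable ℝ f)
    (hs : ∀ x y, ‖gradient f x - gradient f y‖ ≤ L * ‖x - y‖)
    (hh : StrongConvexOn Set.univ μ h) (u : E) {z y v x g z' y' : E}
    (hx : x = τ₁ • z + τ₂ • v + (1 - τ₁ - τ₂) • y)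
    (hz' : ∀ p, ⟪g, z'⟫ + 1 / (2 * α) * ‖z' - z‖ ^ 2 + h z'
      ≤ ⟪g, p⟫ + 1 / (2 * α) * ‖p - z‖ ^ 2 + h p)
    (hy' : ∀ p, ⟪g, y'⟫ + 3 * L / 2 * ‖y' - x‖ ^ 2 + h y'
      ≤ ⟪g, p⟫ + 3 * L / 2 * ‖p - x‖ ^ 2 + h p) :
    0 ≤ (1 - τ₁ - τ₂) / τ₁ * ((f y + h y) - (f u + h u))
      - 1 / τ₁ * ((f y' + h y') - (f u + h u)) + τ₂ / τ₁ * ((f v + h v) - (f u + h u))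
      + (1 / (2 * α) + μ / 12) * ‖z - u‖ ^ 2 - (1 + α * μ) / (2 * α) * ‖z' - u‖ ^ 2
      + (1 / (4 * τ₁ * L) + 3 / μ) * ‖g - gradient f x‖ ^ 2 := by
  set e := g - gradient f x with he
  set q := gradient f x with hq
  have hg : g = q + e := by rw [he]; abel
  set w := τ₁ • z' + τ₂ • v + (1 - τ₁ - τ₂) • y with hw
  have hxw : x - w = τ₁ • (z - z') := by rw [hx, hw, smul_sub]; abel
  have hτ₃ : 0 ≤ 1 - τ₁ - τ₂ := by linarith
  -- mirror step
  have hz1 := proximal_inequality (c := 1 / α) hh (g := g) (w := z) (p := z') (by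
    intro p
    have := hz' p
    rwa [show 1 / (2 * α) = 1 / α / 2 by field_simp] at this) u
  -- convexity of `f`
  have hfu := hfconv.add_inner_gradient_le hf x u
  have hfy := hfconv.add_inner_gradient_le hf x y
  have hfv := hfconv.add_inner_gradient_le hf x v
  have hdesc := le_add_inner_gradient_add_sq hf hs x y'
  rw [← hq] at hfu hfy hfv hdesc
  -- gradient step
  have hyw := hy' w
  have hhw : h w ≤ τ₁ * h z' + τ₂ * h v + (1 - τ₁ - τ₂) * h y := by
    have hhc : ConvexOn ℝ Set.univ h := UniformConvexOn.convexOn hh fun r => by simp only [Pi.zero_apply]; positivity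
    have := hhc.map_sum_le (t := Finset.univ) (w := ![τ₁, τ₂, 1 - τ₁ - τ₂]) (p := ![z', v, y])
      (by intro i _; fin_cases i <;> simp <;> linarith) (by simp [Fin.sum_univ_three])
      (by simp)
    simpa [Fin.sum_univ_three] using this
  -- Young inequalities
  have hyoung1 : -⟪e, z - u⟫ ≤ μ / 12 * ‖z - u‖ ^ 2 + 3 / μ * ‖e‖ ^ 2 := by
    have h0 : 0 ≤ (μ / 12) * ‖(z - u) + (6 / μ) • e‖ ^ 2 := by positivity
    rw [norm_add_sq_real, inner_smul_right, norm_smul, Real.norm_of_nonneg (by positivity),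
      real_inner_comm] at h0
    have : (μ / 12) * (‖z - u‖ ^ 2 + 2 * (6 / μ * ⟪e, z - u⟫) + (6 / μ * ‖e‖) ^ 2)
      = μ / 12 * ‖z - u‖ ^ 2 + ⟪e, z - u⟫ + 3 / μ * ‖e‖ ^ 2 := by field_simp; ring
    linarith
  have hyoung2 : ⟪e, x - y'⟫ ≤ L * ‖y' - x‖ ^ 2 + 1 / (4 * L) * ‖e‖ ^ 2 := by
    have h0 : 0 ≤ L * ‖(y' - x) + (1 / (2 * L)) • e‖ ^ 2 := by positivity
    rw [norm_add_sq_real, inner_smul_right, norm_smul, Real.norm_of_nonneg (by positivity),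
      real_inner_comm] at h0
    have h2 : L * (‖y' - x‖ ^ 2 + 2 * (1 / (2 * L) * ⟪e, y' - x⟫) + (1 / (2 * L) * ‖e‖) ^ 2)
      = L * ‖y' - x‖ ^ 2 + ⟪e, y' - x⟫ + 1 / (4 * L) * ‖e‖ ^ 2 := by field_simp; ring
    rw [← neg_sub y' x, inner_neg_right]
    linarith
  -- the step-size condition
  have hstep : 3 * L / 2 * ‖w - x‖ ^ 2 ≤ τ₁ * (1 / (2 * α) * ‖z' - z‖ ^ 2) := by
    have h1 : ‖w - x‖ = τ₁ * ‖z' - z‖ := by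
      rw [norm_sub_rev, hxw, norm_smul, Real.norm_of_nonneg hτ₁.le, norm_sub_rev]
    have h2 : 3 * L * τ₁ ≤ 1 / α := by
      rw [le_div_iff₀ (by positivity)] at hτ₁' ⊢
      linarith
    have h3 := mul_le_mul_of_nonneg_right h2 (by positivity : 0 ≤ τ₁ / 2 * ‖z' - z‖ ^ 2)
    rw [h1]
    calc _ = 3 * L * τ₁ * (τ₁ / 2 * ‖z' - z‖ ^ 2) := by ring
      _ ≤ _ := h3
      _ = _ := by field_simp
  -- linear identities
  have hlin1 : τ₁ * ⟪q, x - z⟫ = (1 - τ₁ - τ₂) * ⟪q, y - x⟫ + τ₂ * ⟪q, v - x⟫ := by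
    simp only [← real_inner_smul_right, ← inner_add_right]
    congr 1
    have : τ₁ • z = x - τ₂ • v - (1 - τ₁ - τ₂) • y := by rw [hx]; abel
    rw [smul_sub, this]
    module
  have hlin2 : ⟪g, x - w⟫ = τ₁ * ⟪g, z - z'⟫ := by rw [hxw, inner_smul_right]
  rw [norm_sub_rev u z', norm_sub_rev u z] at hz1
  have main : 0 ≤ τ₁ * ((1 - τ₁ - τ₂) / τ₁ * ((f y + h y) - (f u + h u))
      - 1 / τ₁ * ((f y' + h y') - (f u + h u)) + τ₂ / τ₁ * ((f v + h v) - (f u + h u))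
      + (1 / (2 * α) + μ / 12) * ‖z - u‖ ^ 2 - (1 + α * μ) / (2 * α) * ‖z' - u‖ ^ 2
      + (1 / (4 * τ₁ * L) + 3 / μ) * ‖e‖ ^ 2) := by
    have hexp : τ₁ * ((1 - τ₁ - τ₂) / τ₁ * ((f y + h y) - (f u + h u))
      - 1 / τ₁ * ((f y' + h y') - (f u + h u)) + τ₂ / τ₁ * ((f v + h v) - (f u + h u))
      + (1 / (2 * α) + μ / 12) * ‖z - u‖ ^ 2 - (1 + α * μ) / (2 * α) * ‖z' - u‖ ^ 2
      + (1 / (4 * τ₁ * L) + 3 / μ) * ‖e‖ ^ 2) =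
      (1 - τ₁ - τ₂) * ((f y + h y) - (f u + h u)) - ((f y' + h y') - (f u + h u))
      + τ₂ * ((f v + h v) - (f u + h u))
      + τ₁ * ((1 / α / 2 + μ / 12) * ‖z - u‖ ^ 2 - (1 / α + μ) / 2 * ‖z' - u‖ ^ 2)
      + 1 / (4 * L) * ‖e‖ ^ 2 + τ₁ * (3 / μ * ‖e‖ ^ 2) := by
      field_simp
      ring
    rw [hexp]
    rw [show 1 / (2 * α) = 1 / α / 2 by field_simp] at hstep
    have hz1' := mul_le_mul_of_nonneg_left hz1 hτ₁.le
    have hfu' := mul_le_mul_of_nonneg_left hfu hτ₁.le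
    have hfy' := mul_le_mul_of_nonneg_left hfy hτ₃
    have hfv' := mul_le_mul_of_nonneg_left hfv hτ₂
    have hyoung1' := mul_le_mul_of_nonneg_left hyoung1 hτ₁.le
    have hge : ∀ p, ⟪g, p⟫ = ⟪q, p⟫ + ⟪e, p⟫ := fun p => by rw [hg, inner_add_left]
    simp only [hge, inner_sub_right] at hz1' hfu' hfy' hfv' hyoung1' hdesc hyw hyoung2 hlin1 hlin2
    linarith
  exact nonneg_of_mul_nonneg_right main hτ₁

end Convexity

lemma norm_add₃_sq_le {E : Type*} [SeminormedAddCommGroup E] (a b c : E) :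
    ‖a + b + c‖ ^ 2 ≤ 3 * (‖a‖ ^ 2 + ‖b‖ ^ 2 + ‖c‖ ^ 2) := by
  refine (pow_le_pow_left₀ (norm_nonneg _) norm_add₃_le 2).trans ?_
  nlinarith [sq_nonneg (‖a‖ - ‖b‖), sq_nonneg (‖b‖ - ‖c‖), sq_nonneg (‖a‖ - ‖c‖)]

section Sampling

variable {E : Type*} [NormedAddCommGroup E] [InnerProductSpace ℝ E] {n : ℕ}

lemma sum_norm_sq_sum_of_sum_eq_zero (d : Fin n → E) (hd : ∑ j, d j = 0) (A : ℕ) :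
    (n : ℝ) * ∑ σ : Fin A → Fin n, ‖∑ t, d (σ t)‖ ^ 2 = A * (n : ℝ) ^ A * ∑ j, ‖d j‖ ^ 2 := by
  induction A with
  | zero => simp
  | succ A ih =>
    rw [← (Fin.consEquiv fun _ => Fin n).sum_comp, Fintype.sum_prod_type]
    have hj : ∀ j : Fin n, ∑ σ : Fin A → Fin n,
        ‖∑ t, d ((Fin.consEquiv fun _ => Fin n) (j, σ) t)‖ ^ 2 = (n : ℝ) ^ A * ‖d j‖ ^ 2
          + 2 * ⟪d j, ∑ σ : Fin A → Fin n, ∑ t, d (σ t)⟫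
          + ∑ σ : Fin A → Fin n, ‖∑ t, d (σ t)‖ ^ 2 := by
      intro j
      simp [Fin.consEquiv, Fin.sum_univ_succ, norm_add_sq_real, Finset.sum_add_distrib, inner_sum,
        Finset.mul_sum]
    simp_rw [hj]
    rw [Finset.sum_add_distrib, Finset.sum_add_distrib, ← Finset.mul_sum, ← Finset.mul_sum,
      ← sum_inner, hd, inner_zero_left, Finset.sum_const, Finset.card_univ, Fintype.card_fin,
      nsmul_eq_mul, ih]
    push_cast
    ring

lemma sum_norm_sq_sub_mean_le (hn : 0 < n) (u : Fin n → E) :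
    ∑ j, ‖u j - (n : ℝ)⁻¹ • ∑ i, u i‖ ^ 2 ≤ ∑ j, ‖u j‖ ^ 2 := by
  have hn' : (n : ℝ) ≠ 0 := by positivity
  set m := (n : ℝ)⁻¹ • ∑ i, u i with hm
  have hs : ∑ i, u i = (n : ℝ) • m := by rw [hm, smul_inv_smul₀ hn']
  simp_rw [norm_sub_sq_real]
  rw [Finset.sum_add_distrib, Finset.sum_sub_distrib, ← Finset.mul_sum, ← sum_inner, hs,
    real_inner_smul_left, real_inner_self_eq_norm_sq]
  simp only [Finset.sum_const, Finset.card_univ, Fintype.card_fin, nsmul_eq_mul]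
  nlinarith [mul_nonneg n.cast_nonneg (sq_nonneg ‖m‖) (α := ℝ)]

/-- The second moment of the deviation of a sample mean, sampling with replacement. -/
lemma mean_norm_sq_sampleMean_sub_le (hn : 0 < n) (u : Fin n → E) {A : ℕ} (hA : 1 ≤ A) :
    ((n : ℝ) ^ A)⁻¹ * ∑ σ : Fin A → Fin n,
        ‖(A : ℝ)⁻¹ • ∑ t, u (σ t) - (n : ℝ)⁻¹ • ∑ j, u j‖ ^ 2
      ≤ (A : ℝ)⁻¹ * ((n : ℝ)⁻¹ * ∑ j, ‖u j‖ ^ 2) := by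
  have hn' : (0 : ℝ) < n := by positivity
  have hA' : (0 : ℝ) < A := by exact_mod_cast hA
  set m := (n : ℝ)⁻¹ • ∑ i, u i with hm
  have hd : ∑ j, (u j - m) = 0 := by
    rw [Finset.sum_sub_distrib, Finset.sum_const, Finset.card_univ, Fintype.card_fin,
      ← Nat.cast_smul_eq_nsmul ℝ, hm, smul_inv_smul₀ hn'.ne', sub_self]
  have h1 : ∀ σ : Fin A → Fin n, ‖(A : ℝ)⁻¹ • ∑ t, u (σ t) - m‖ ^ 2
      = (A : ℝ)⁻¹ ^ 2 * ‖∑ t, (u (σ t) - m)‖ ^ 2 := by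
    intro σ
    rw [Finset.sum_sub_distrib, Finset.sum_const, Finset.card_univ, Fintype.card_fin,
      ← Nat.cast_smul_eq_nsmul ℝ, ← mul_pow, ← Real.norm_of_nonneg (inv_nonneg.2 hA'.le),
      ← norm_smul, smul_sub, Real.norm_of_nonneg (inv_nonneg.2 hA'.le), inv_smul_smul₀ hA'.ne']
  have h2 := sum_norm_sq_sum_of_sum_eq_zero (fun j => u j - m) hd A
  have h3 : ∑ σ : Fin A → Fin n, ‖∑ t, (u (σ t) - m)‖ ^ 2
      = (n : ℝ)⁻¹ * (A * (n : ℝ) ^ A * ∑ j, ‖u j - m‖ ^ 2) := by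
    rw [← h2, inv_mul_cancel_left₀ hn'.ne']
  simp_rw [h1]
  rw [← Finset.mul_sum, h3]
  calc _ = (A : ℝ)⁻¹ * ((n : ℝ)⁻¹ * ∑ j, ‖u j - m‖ ^ 2) := by field_simp
    _ ≤ _ := by gcongr _ * (_ * ?_); exact sum_norm_sq_sub_mean_le hn u

lemma mean_mean_add {n A B : ℕ} (hn : 0 < n) (p : (Fin B → Fin n) → ℝ) (q : (Fin A → Fin n) → ℝ) :
    ((n : ℝ) ^ A)⁻¹ * ((n : ℝ) ^ B)⁻¹ * ∑ σ, ∑ τ, (p τ + q σ)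
      = ((n : ℝ) ^ B)⁻¹ * ∑ τ, p τ + ((n : ℝ) ^ A)⁻¹ * ∑ σ, q σ := by
  have hn' : (0 : ℝ) < n := by exact_mod_cast hn
  simp only [Finset.sum_add_distrib, ← Finset.mul_sum, Finset.sum_const, Finset.card_univ,
    Fintype.card_pi, Fintype.card_fin, Finset.prod_const, nsmul_eq_mul]
  push_cast
  field_simp

end Sampling

section Frobenius

variable {k l : Type*} [Fintype k] [Fintype l]

lemma frobNorm_nonneg (M : Matrix k l ℝ) : 0 ≤ frobNorm M := Real.sqrt_nonneg _

lemma frobNorm_sq (M : Matrix k l ℝ) : frobNorm M ^ 2 = ∑ i, ∑ j, M i j ^ 2 :=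
  Real.sq_sqrt (by positivity)

lemma frobNorm_transpose (M : Matrix k l ℝ) : frobNorm Mᵀ = frobNorm M := by
  simp only [frobNorm, Matrix.transpose_apply]
  rw [Finset.sum_comm]

lemma norm_toEuclideanLin_le [DecidableEq l] (M : Matrix k l ℝ) (v : EuclideanSpace ℝ l) :
    ‖Matrix.toEuclideanLin M v‖ ≤ frobNorm M * ‖v‖ := by
  refine le_of_sq_le_sq ?_ (mul_nonneg (frobNorm_nonneg M) (norm_nonneg v))
  rw [mul_pow, frobNorm_sq, EuclideanSpace.real_norm_sq_eq, EuclideanSpace.real_norm_sq_eq,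
    Finset.sum_mul]
  refine Finset.sum_le_sum fun i _ => ?_
  simpa [Matrix.toLpLin_apply, Matrix.mulVec, dotProduct] using
    Finset.sum_mul_sq_le_sq_mul_sq Finset.univ (M i) v

lemma mean_frobNorm_sq_sampleMean_sub_le {n : ℕ} (hn : 0 < n) (D : Fin n → Matrix k l ℝ)
    {B : ℕ} (hB : 1 ≤ B) :
    ((n : ℝ) ^ B)⁻¹ * ∑ τ : Fin B → Fin n,
        frobNorm ((B : ℝ)⁻¹ • ∑ t, D (τ t) - (n : ℝ)⁻¹ • ∑ j, D j) ^ 2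
      ≤ (B : ℝ)⁻¹ * ((n : ℝ)⁻¹ * ∑ j, frobNorm (D j) ^ 2) := by
  let vec : Matrix k l ℝ →ₗ[ℝ] EuclideanSpace ℝ (k × l) :=
    { toFun := fun M => WithLp.toLp 2 fun p => M p.1 p.2
      map_add' := fun _ _ => rfl
      map_smul' := fun _ _ => rfl }
  have hvec : ∀ M, frobNorm M ^ 2 = ‖vec M‖ ^ 2 := fun M => by
    rw [frobNorm_sq, EuclideanSpace.real_norm_sq_eq, Fintype.sum_prod_type]
    rfl
  simpa only [hvec, map_sub, map_smul, map_sum] using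
    mean_norm_sq_sampleMean_sub_le hn (fun j => vec (D j)) hB

lemma frobNorm_mean_le {n : ℕ} (hn : 0 < n) (D : Fin n → Matrix k l ℝ) {C : ℝ}
    (hD : ∀ j, frobNorm (D j) ≤ C) : frobNorm ((n : ℝ)⁻¹ • ∑ j, D j) ≤ C := by
  have hn' : (0 : ℝ) < n := by exact_mod_cast hn
  let _ := Matrix.frobeniusSeminormedAddCommGroup (m := k) (n := l) (α := ℝ)
  let _ := Matrix.frobeniusNormedSpace (m := k) (n := l) (R := ℝ) (α := ℝ)
  have hfr : ∀ P : Matrix k l ℝ, frobNorm P = ‖P‖ := fun P => by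
    rw [Matrix.frobenius_norm_def, frobNorm, Real.sqrt_eq_rpow]
    simp
  simp only [hfr] at hD ⊢
  rw [norm_smul, norm_inv, Real.norm_natCast, inv_mul_le_iff₀ hn']
  refine (norm_sum_le _ _).trans ((Finset.sum_le_sum fun j _ => hD j).trans ?_)
  simp

end Frobenius

lemma norm_sub_le_of_frobNorm_le {k l : Type*} [Fintype k] [Fintype l] [DecidableEq l]
    {G : EuclideanSpace ℝ l → EuclideanSpace ℝ k} {DG : EuclideanSpace ℝ l → Matrix k l ℝ} {C : ℝ}
    (hG : ∀ x, HasFDerivAt G (Matrix.toEuclideanLin (DG x)).toContinuousLinearMap x)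
    (hC : ∀ x, frobNorm (DG x) ≤ C) (x y : EuclideanSpace ℝ l) : ‖G x - G y‖ ≤ C * ‖x - y‖ := by
  refine convex_univ.norm_image_sub_le_of_norm_hasFDerivWithin_le
    (fun z _ => (hG z).hasFDerivWithinAt) (fun z _ => ?_) (Set.mem_univ y) (Set.mem_univ x)
  refine ContinuousLinearMap.opNorm_le_bound _ ((frobNorm_nonneg _).trans (hC z)) fun v => ?_
  exact (norm_toEuclideanLin_le (DG z) v).trans
    (mul_le_mul_of_nonneg_right (hC z) (norm_nonneg v))

/-- Error of the product of an approximate transposed Jacobian with an approximate vector. -/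
lemma norm_sq_transpose_mul_sub_le {k l : Type*} [Fintype k] [Fintype l] [DecidableEq k]
    (P Q : Matrix k l ℝ) (a b : EuclideanSpace ℝ k) {p q : ℝ} (ha : ‖a‖ ≤ p)
    (hQ : frobNorm Q ≤ q) :
    ‖Matrix.toEuclideanLin Pᵀ a - Matrix.toEuclideanLin Qᵀ b‖ ^ 2
      ≤ 2 * p ^ 2 * frobNorm (P - Q) ^ 2 + 2 * q ^ 2 * ‖a - b‖ ^ 2 := by
  have hsplit : Matrix.toEuclideanLin Pᵀ a - Matrix.toEuclideanLin Qᵀ b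
      = Matrix.toEuclideanLin (P - Q)ᵀ a + Matrix.toEuclideanLin Qᵀ (a - b) := by
    rw [Matrix.transpose_sub, map_sub, map_sub, LinearMap.sub_apply]
    abel
  have h1 := norm_toEuclideanLin_le (P - Q)ᵀ a
  have h2 := norm_toEuclideanLin_le Qᵀ (a - b)
  rw [frobNorm_transpose] at h1 h2
  have h1' := h1.trans (mul_le_mul_of_nonneg_left ha (frobNorm_nonneg _))
  have h2' := h2.trans (mul_le_mul_of_nonneg_right hQ (norm_nonneg _))
  have h1s := pow_le_pow_left₀ (norm_nonneg _) h1' 2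
  have h2s := pow_le_pow_left₀ (norm_nonneg _) h2' 2
  have h3 := pow_le_pow_left₀ (norm_nonneg _) (norm_add_le (Matrix.toEuclideanLin (P - Q)ᵀ a)
    (Matrix.toEuclideanLin Qᵀ (a - b))) 2
  rw [hsplit]
  have h4 := add_sq_le (a := ‖Matrix.toEuclideanLin (P - Q)ᵀ a‖)
    (b := ‖Matrix.toEuclideanLin Qᵀ (a - b)‖)
  rw [mul_pow] at h1s h2s
  linarith

/-- one-inner-iteration inequality in expectation for Option I
(Lemma `cp2` with the Option I variance-reduced estimator). -/
theorem optionI_one_inner_iteration_expectation_bound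
    (N1 N2 n2 : ℕ) (hn2 : 0 < n2)
    (LG BG LF BF L μ α τ₁ τ₂ : ℝ) (hL : 0 < L) (hμ : 0 < μ) (hα : 0 < α)
    (hτ₁ : 0 < τ₁) (hτ₁' : τ₁ ≤ 1 / (3 * α * L)) (hτ₂ : 0 ≤ τ₂) (hτ₂' : τ₂ ≤ 1 - τ₁)
    (G : Fin n2 → EuclideanSpace ℝ (Fin N2) → EuclideanSpace ℝ (Fin N1))
    (DG : Fin n2 → EuclideanSpace ℝ (Fin N2) → Matrix (Fin N1) (Fin N2) ℝ)
    (hGd : ∀ j x, HasFDerivAt (G j) ((Matrix.toEuclideanLin (DG j x)).toContinuousLinearMap) x)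
    (hGs : ∀ j x y, frobNorm (DG j x - DG j y) ≤ LG * ‖x - y‖)
    (hGb : ∀ j x, frobNorm (DG j x) ≤ BG)
    (F : EuclideanSpace ℝ (Fin N1) → ℝ) (hFd : Differentiable ℝ F)
    (hFs : ∀ p q, ‖gradient F p - gradient F q‖ ≤ LF * ‖p - q‖)
    (hFb : ∀ y, ‖gradient F y‖ ≤ BF)
    (Gbar : EuclideanSpace ℝ (Fin N2) → EuclideanSpace ℝ (Fin N1))
    (hGbar : Gbar = fun x => (n2 : ℝ)⁻¹ • ∑ j, G j x)
    (DGbar : EuclideanSpace ℝ (Fin N2) → Matrix (Fin N1) (Fin N2) ℝ)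
    (hDGbar : DGbar = fun x => (n2 : ℝ)⁻¹ • ∑ j, DG j x)
    (f h : EuclideanSpace ℝ (Fin N2) → ℝ)
    (hfconv : ConvexOn ℝ Set.univ f)
    (hf : Differentiable ℝ f)
    (hgradf : ∀ x, gradient f x = Matrix.toEuclideanLin (DGbar x)ᵀ (gradient F (Gbar x)))
    (hfsmooth : ∀ x y : EuclideanSpace ℝ (Fin N2),
      ‖gradient f x - gradient f y‖ ≤ L * ‖x - y‖)
    (hhconv : ConvexOn ℝ Set.univ (fun x => h x - μ / 2 * ‖x‖ ^ 2))
    (H : EuclideanSpace ℝ (Fin N2) → ℝ) (hH : H = fun z => f z + h z)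
    (xs : EuclideanSpace ℝ (Fin N2)) (hmin : ∀ u, H xs ≤ H u)
    (zk yk xt x1 : EuclideanSpace ℝ (Fin N2))
    (hx1 : x1 = τ₁ • zk + τ₂ • xt + (1 - τ₁ - τ₂) • yk)
    (A B : ℕ) (hA : 1 ≤ A) (hB : 1 ≤ B)
    (Ghat : (Fin A → Fin n2) → EuclideanSpace ℝ (Fin N1))
    (hGhat : ∀ σ, Ghat σ = ((A : ℝ)⁻¹ • ∑ t, (G (σ t) x1 - G (σ t) xt)) + Gbar xt)
    (DGhat : (Fin B → Fin n2) → Matrix (Fin N1) (Fin N2) ℝ)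
    (hDGhat : ∀ τ, DGhat τ = ((B : ℝ)⁻¹ • ∑ t, (DG (τ t) x1 - DG (τ t) xt)) + DGbar xt)
    (gradEst : (Fin A → Fin n2) → (Fin B → Fin n2) → EuclideanSpace ℝ (Fin N2))
    (hgradEst : ∀ σ τ, gradEst σ τ = Matrix.toEuclideanLin (DGhat τ)ᵀ (gradient F (Ghat σ)))
    (z1 y1 : (Fin A → Fin n2) → (Fin B → Fin n2) → EuclideanSpace ℝ (Fin N2))
    (hz1 : ∀ σ τ, ∀ z : EuclideanSpace ℝ (Fin N2),
      ⟪gradEst σ τ, z1 σ τ⟫ + 1 / (2 * α) * ‖z1 σ τ - zk‖ ^ 2 + h (z1 σ τ)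
        ≤ ⟪gradEst σ τ, z⟫ + 1 / (2 * α) * ‖z - zk‖ ^ 2 + h z)
    (hy1 : ∀ σ τ, ∀ y : EuclideanSpace ℝ (Fin N2),
      ⟪gradEst σ τ, y1 σ τ⟫ + 3 * L / 2 * ‖y1 σ τ - x1‖ ^ 2 + h (y1 σ τ)
        ≤ ⟪gradEst σ τ, y⟫ + 3 * L / 2 * ‖y - x1‖ ^ 2 + h y)
    (M : ℝ)
    (hM : M = 3 * (1 / (4 * τ₁ * L) + 3 / μ)
      * (2 * BG ^ 4 * LF ^ 2 / A + 2 * BF ^ 2 * LG ^ 2 / B)) :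
    0 ≤ ((1 - τ₁ - τ₂) / τ₁ + 2 * M / μ * (1 - τ₁ - τ₂) ^ 2) * (H yk - H xs)
        - 1 / τ₁ * (((n2 : ℝ) ^ A)⁻¹ * ((n2 : ℝ) ^ B)⁻¹ *
            (∑ σ : Fin A → Fin n2, ∑ τ : Fin B → Fin n2, H (y1 σ τ)) - H xs)
        + (τ₂ / τ₁ + 2 * M / μ * (1 - τ₂) ^ 2) * (H xt - H xs)
        + (1 / (2 * α) + μ / 12 + M * τ₁ ^ 2) * ‖zk - xs‖ ^ 2
        - (1 + α * μ) / (2 * α) * (((n2 : ℝ) ^ A)⁻¹ * ((n2 : ℝ) ^ B)⁻¹ *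
            ∑ σ : Fin A → Fin n2, ∑ τ : Fin B → Fin n2, ‖z1 σ τ - xs‖ ^ 2) := by
  have hn : (0 : ℝ) < n2 := by exact_mod_cast hn2
  have hA' : (0 : ℝ) < A := by exact_mod_cast hA
  have hB' : (0 : ℝ) < B := by exact_mod_cast hB
  have hhs : StrongConvexOn Set.univ μ h := strongConvexOn_iff_convex.2 hhconv
  have hHs : StrongConvexOn Set.univ μ H := by
    rw [strongConvexOn_iff_convex, hH]
    refine (hfconv.add hhconv).congr fun z _ => ?_
    simp only [Pi.add_apply]
    ring
  have hdist : ∀ u, ‖u - xs‖ ^ 2 ≤ 2 / μ * (H u - H xs) := fun u => by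
    have := hHs.add_sq_le_of_forall_le hmin u
    rw [div_mul_eq_mul_div, le_div_iff₀ hμ]
    linarith
  have hDGbar_le : frobNorm (DGbar x1) ≤ BG := by
    rw [hDGbar]
    exact frobNorm_mean_le hn2 (fun j => DG j x1) fun j => hGb j x1
  have hGhat_mean : ((n2 : ℝ) ^ A)⁻¹ * ∑ σ, ‖Ghat σ - Gbar x1‖ ^ 2
      ≤ (A : ℝ)⁻¹ * (BG ^ 2 * ‖x1 - xt‖ ^ 2) := by
    have h1 := mean_norm_sq_sampleMean_sub_le hn2 (fun j => G j x1 - G j xt) hA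
    have h2 : ∀ σ, Ghat σ - Gbar x1 = (A : ℝ)⁻¹ • ∑ t, (G (σ t) x1 - G (σ t) xt)
        - (n2 : ℝ)⁻¹ • ∑ j, (G j x1 - G j xt) := fun σ => by
      rw [hGhat, hGbar, Finset.sum_sub_distrib (f := fun j => G j x1), smul_sub _ (∑ j, G j x1)]
      abel
    simp_rw [h2]
    refine h1.trans ?_
    gcongr _ * ?_
    rw [inv_mul_le_iff₀ hn]
    refine (Finset.sum_le_sum fun j _ => pow_le_pow_left₀ (norm_nonneg _)
      (norm_sub_le_of_frobNorm_le (hGd j) (hGb j) x1 xt) 2).trans ?_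
    simp [mul_pow]
  have hDGhat_mean : ((n2 : ℝ) ^ B)⁻¹ * ∑ τ, frobNorm (DGhat τ - DGbar x1) ^ 2
      ≤ (B : ℝ)⁻¹ * (LG ^ 2 * ‖x1 - xt‖ ^ 2) := by
    have h1 := mean_frobNorm_sq_sampleMean_sub_le hn2 (fun j => DG j x1 - DG j xt) hB
    have h2 : ∀ τ, DGhat τ - DGbar x1 = (B : ℝ)⁻¹ • ∑ t, (DG (τ t) x1 - DG (τ t) xt)
        - (n2 : ℝ)⁻¹ • ∑ j, (DG j x1 - DG j xt) := fun τ => by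
      rw [hDGhat, hDGbar, Finset.sum_sub_distrib (f := fun j => DG j x1),
        smul_sub _ (∑ j, DG j x1)]
      abel
    simp_rw [h2]
    refine h1.trans ?_
    gcongr _ * ?_
    rw [inv_mul_le_iff₀ hn]
    refine (Finset.sum_le_sum fun j _ => pow_le_pow_left₀ (frobNorm_nonneg _)
      (hGs j x1 xt) 2).trans ?_
    simp [mul_pow]
  set V := 2 * BG ^ 4 * LF ^ 2 / A + 2 * BF ^ 2 * LG ^ 2 / B with hV
  set C := 1 / (4 * τ₁ * L) + 3 / μ
  have hV0 : 0 ≤ V := by positivity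
  have hC0 : 0 ≤ C := by positivity
  set w := ((n2 : ℝ) ^ A)⁻¹ * ((n2 : ℝ) ^ B)⁻¹ with hw
  have hw0 : 0 ≤ w := by positivity
  have herr : ∀ σ τ, ‖gradEst σ τ - gradient f x1‖ ^ 2
      ≤ 2 * BF ^ 2 * frobNorm (DGhat τ - DGbar x1) ^ 2
        + 2 * BG ^ 2 * (LF ^ 2 * ‖Ghat σ - Gbar x1‖ ^ 2) := fun σ τ => by
    rw [hgradEst, hgradf]
    refine (norm_sq_transpose_mul_sub_le (DGhat τ) (DGbar x1) _ (gradient F (Gbar x1))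
      (hFb (Ghat σ)) hDGbar_le).trans ?_
    rw [← mul_pow LF]
    gcongr
    exact hFs _ _
  have hvar : w * ∑ σ, ∑ τ, ‖gradEst σ τ - gradient f x1‖ ^ 2 ≤ V * ‖x1 - xt‖ ^ 2 := by
    have h1 := mul_le_mul_of_nonneg_left
      (Finset.sum_le_sum fun σ (_ : σ ∈ Finset.univ) =>
        Finset.sum_le_sum fun τ (_ : τ ∈ Finset.univ) => herr σ τ) hw0
    refine h1.trans ?_
    rw [mean_mean_add hn2, ← Finset.mul_sum, ← Finset.mul_sum, ← Finset.mul_sum,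
      mul_left_comm _ (2 * BF ^ 2), mul_left_comm _ (2 * BG ^ 2), mul_left_comm _ (LF ^ 2),
      ← mul_assoc (2 * BG ^ 2)]
    have hVx : V * ‖x1 - xt‖ ^ 2 = 2 * BF ^ 2 * ((B : ℝ)⁻¹ * (LG ^ 2 * ‖x1 - xt‖ ^ 2))
        + 2 * BG ^ 2 * LF ^ 2 * ((A : ℝ)⁻¹ * (BG ^ 2 * ‖x1 - xt‖ ^ 2)) := by
      rw [hV]
      field_simp
      ring
    rw [hVx]
    gcongr
  have hxdist : ‖x1 - xt‖ ^ 2 ≤ 3 * (τ₁ ^ 2 * ‖zk - xs‖ ^ 2 + (1 - τ₂) ^ 2 * ‖xt - xs‖ ^ 2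
      + (1 - τ₁ - τ₂) ^ 2 * ‖yk - xs‖ ^ 2) := by
    have h1 : x1 - xt = τ₁ • (zk - xs) + (-(1 - τ₂)) • (xt - xs) + (1 - τ₁ - τ₂) • (yk - xs) := by
      rw [hx1]
      module
    rw [h1]
    refine (norm_add₃_sq_le _ _ _).trans (le_of_eq ?_)
    simp only [norm_smul, mul_pow, Real.norm_eq_abs, sq_abs, neg_sq]
  have hpt : ∀ σ τ, 1 / τ₁ * (H (y1 σ τ)) + (1 + α * μ) / (2 * α) * ‖z1 σ τ - xs‖ ^ 2
      ≤ (1 - τ₁ - τ₂) / τ₁ * (H yk - H xs) + 1 / τ₁ * H xs + τ₂ / τ₁ * (H xt - H xs)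
        + (1 / (2 * α) + μ / 12) * ‖zk - xs‖ ^ 2
        + C * ‖gradEst σ τ - gradient f x1‖ ^ 2 := fun σ τ => by
    have := coupled_proximal_step hL hμ hα hτ₁ hτ₁' hτ₂ hτ₂' hfconv hf hfsmooth hhs xs hx1
      (hz1 σ τ) (hy1 σ τ)
    simp only [hH]
    linarith
  have hsum := mul_le_mul_of_nonneg_left
    (Finset.sum_le_sum fun σ (_ : σ ∈ Finset.univ) =>
      Finset.sum_le_sum fun τ (_ : τ ∈ Finset.univ) => hpt σ τ) hw0
  have hsplit : ∀ (a b : ℝ) (p q : (Fin A → Fin n2) → (Fin B → Fin n2) → ℝ),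
      w * ∑ σ, ∑ τ, (a * p σ τ + b * q σ τ)
        = a * (w * ∑ σ, ∑ τ, p σ τ) + b * (w * ∑ σ, ∑ τ, q σ τ) := fun a b p q => by
    simp only [Finset.sum_add_distrib, ← Finset.mul_sum]
    ring
  have hconst : ∀ (a b : ℝ) (q : (Fin A → Fin n2) → (Fin B → Fin n2) → ℝ),
      w * ∑ σ, ∑ τ, (a + b * q σ τ) = a + b * (w * ∑ σ, ∑ τ, q σ τ) := fun a b q => by
    simp only [Finset.sum_add_distrib, mul_add, ← Finset.mul_sum, Finset.sum_const,
      Finset.card_univ, Fintype.card_pi, Fintype.card_fin, Finset.prod_const, nsmul_eq_mul, hw]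
    push_cast
    field_simp
  rw [hsplit, hconst] at hsum
  have b1 := mul_le_mul_of_nonneg_left hvar hC0
  have b2 := mul_le_mul_of_nonneg_left hxdist (mul_nonneg hC0 hV0)
  have b3 := mul_le_mul_of_nonneg_left (hdist xt)
    (by positivity : 0 ≤ 3 * C * V * (1 - τ₂) ^ 2)
  have b4 := mul_le_mul_of_nonneg_left (hdist yk)
    (by positivity : 0 ≤ 3 * C * V * (1 - τ₁ - τ₂) ^ 2)
  have hcoef : 2 * M / μ = 3 * C * V * (2 / μ) := by rw [hM]; ring
  rw [hcoef, hM]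
  linarith
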